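/- arXiv:2010.15641 — 2 statements merged into one kernel-verified Lean document; each statement's English description precedes it below -/
import Mathlib

section
/- The map Φ: ℰ → 𝒱 sending α to the restriction of |·|_{M̂^a} to F along α is surjective: every absolute value on F extending both |·|_L and |·|_M arises as the pullback along some embedding α ∈ ℰ. -/
noncomputable section

/-- A sequence is Cauchy with respect to an absolute value. -/
def AbsCauchy {K : Type*} [Field K] (v : AbsoluteValue K ℝ) (s : ℕ → K) : Prop :=
  ∀ ε : ℝ, 0 < ε → ∃ N : ℕ, ∀ m ≥ N, ∀ n ≥ N, v (s m - s n) < ε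

/-- A sequence tends to a limit with respect to an absolute value. -/
def AbsTendsto {K : Type*} [Field K] (v : AbsoluteValue K ℝ) (s : ℕ → K) (a : K) : Prop :=
  ∀ ε : ℝ, 0 < ε → ∃ N : ℕ, ∀ n ≥ N, v (s n - a) < ε

/-- A field is complete with respect to an absolute value if every Cauchy sequence converges. -/
def AbsComplete {K : Type*} [Field K] (v : AbsoluteValue K ℝ) : Prop :=
  ∀ s : ℕ → K, AbsCauchy v s → ∃ a : K, AbsTendsto v s a

/-- The absolute value `vB` extends the absolute value `vA` along the embedding `f`. -/
def ExtendsAV {A B : Type*} [Field A] [Field B] (vA : AbsoluteValue A ℝ)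
    (vB : AbsoluteValue B ℝ) (f : A →+* B) : Prop :=
  ∀ x : A, vB (f x) = vA x

/-- `(B, vB, f)` is a completion of `(A, vA)`:  `f` is an isometric embedding with dense
image and `B` is complete. -/
structure IsCompletion {A B : Type*} [Field A] [Field B] (vA : AbsoluteValue A ℝ)
    (vB : AbsoluteValue B ℝ) (f : A →+* B) : Prop where
  extendsAV : ExtendsAV vA vB f
  complete : AbsComplete vB
  dense : ∀ y : B, ∀ ε : ℝ, 0 < ε → ∃ x : A, vB (y - f x) < ε

/-- Pullback of an absolute value along an embedding of fields. -/
def AbsoluteValue.comapRH {A B : Type*} [Field A] [Field B]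
    (v : AbsoluteValue B ℝ) (f : A →+* B) : AbsoluteValue A ℝ where
  toFun x := v (f x)
  map_mul' x y := by simp [map_mul]
  nonneg' x := v.nonneg _
  eq_zero' x := by
    rw [map_eq_zero, map_eq_zero]
  add_le' x y := by simpa using v.add_le (f x) (f y)

theorem ExtendsAV.comap_comp {A B C : Type*} [Field A] [Field B] [Field C]
    {vA : AbsoluteValue A ℝ} {vB : AbsoluteValue B ℝ} {vC : AbsoluteValue C ℝ}
    {f : A →+* B} {g : B →+* C} (hf : ExtendsAV vA vB f) (hg : ExtendsAV vB vC g) :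
    ExtendsAV vA vC (g.comp f) := fun x => by
  rw [RingHom.comp_apply, hg, hf]

theorem AbsComplete.completeSpace {A : Type*} [Field A] {v : AbsoluteValue A ℝ}
    (hv : AbsComplete v) :
    letI := v.toNormedField
    CompleteSpace A := by
  let := v.toNormedField
  refine Metric.complete_of_cauchySeq_tendsto fun s hs => ?_
  obtain ⟨a, ha⟩ := hv s fun ε hε => by
    obtain ⟨N, hN⟩ := Metric.cauchySeq_iff.1 hs ε hε
    exact ⟨N, fun m hm n hn => by simpa [dist_eq_norm] using! hN m hm n hn⟩
  refine ⟨a, Metric.tendsto_atTop.2 fun ε hε => ?_⟩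
  obtain ⟨N, hN⟩ := ha ε hε
  exact ⟨N, fun n hn => by simpa [dist_eq_norm] using! hN n hn⟩

theorem ExtendsAV.isometry {A B : Type*} [Field A] [Field B]
    {vA : AbsoluteValue A ℝ} {vB : AbsoluteValue B ℝ} {f : A →+* B} (hf : ExtendsAV vA vB f) :
    letI := vA.toNormedField
    letI := vB.toNormedField
    Isometry f := by
  let := vA.toNormedField
  let := vB.toNormedField
  exact AddMonoidHomClass.isometry_of_norm f hf

theorem IsCompletion.denseRange {A B : Type*} [Field A] [Field B]
    {vA : AbsoluteValue A ℝ} {vB : AbsoluteValue B ℝ} {f : A →+* B} (hf : IsCompletion vA vB f) :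
    letI := vB.toNormedField
    DenseRange f := by
  let := vB.toNormedField
  refine Metric.denseRange_iff.2 fun y ε hε => ?_
  obtain ⟨x, hx⟩ := hf.dense y ε hε
  exact ⟨x, by simpa [dist_eq_norm] using! hx⟩

/-- The universal property of the completion. -/
theorem IsCompletion.exists_extension {A B C : Type*} [Field A] [Field B] [Field C]
    {vA : AbsoluteValue A ℝ} {vB : AbsoluteValue B ℝ} {vC : AbsoluteValue C ℝ}
    {f : A →+* B} {g : A →+* C} (hf : IsCompletion vA vB f) (hC : AbsComplete vC)
    (hg : ExtendsAV vA vC g) :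
    ∃ h : B →+* C, ExtendsAV vB vC h ∧ ∀ x, h (f x) = g x := by
  let := vA.toNormedField
  let := vB.toNormedField
  let := vC.toNormedField
  have : CompleteSpace C := hC.completeSpace
  have hfi : Isometry f := hf.extendsAV.isometry
  have hgi : Isometry g := hg.isometry
  have hd : DenseRange f := hf.denseRange
  let h : B →+* C :=
    IsDenseInducing.extendRingHom hfi.isUniformInducing hd hgi.uniformContinuous
  have hcont : Continuous h :=
    (uniformContinuous_uniformly_extend hfi.isUniformInducing hd
      hgi.uniformContinuous).continuous
  have hcomp : ∀ x, h (f x) = g x := fun x =>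
    IsDenseInducing.extend_eq (hfi.isUniformInducing.isDenseInducing hd) hgi.continuous x
  refine ⟨h, fun y => ?_, hcomp⟩
  have hn : ‖h y‖ = ‖y‖ := by
    refine hd.induction_on y (isClosed_eq hcont.norm continuous_norm) fun x => ?_
    rw [hcomp]
    exact (hg x).trans (hf.extendsAV x).symm
  exact hn

/-- Isometric embeddings of a completion are determined on the dense subfield. -/
theorem IsCompletion.ringHom_ext {A B C : Type*} [Field A] [Field B] [Field C]
    {vA : AbsoluteValue A ℝ} {vB : AbsoluteValue B ℝ} {vC : AbsoluteValue C ℝ}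
    {f : A →+* B} (hf : IsCompletion vA vB f) {g h : B →+* C}
    (hg : ExtendsAV vB vC g) (hh : ExtendsAV vB vC h) (H : ∀ x, g (f x) = h (f x)) (y : B) :
    g y = h y := by
  let := vB.toNormedField
  let := vC.toNormedField
  have hd : DenseRange f := hf.denseRange
  have hgi : Isometry g := hg.isometry
  have hhi : Isometry h := hh.isometry
  exact hd.induction_on y (isClosed_eq hgi.continuous hhi.continuous) H

theorem exists_isCompletion.{u} {A : Type u} [Field A] (v : AbsoluteValue A ℝ) :
    ∃ (B : Type u) (_ : Field B) (vB : AbsoluteValue B ℝ) (f : A →+* B),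
      IsCompletion v vB f := by
  let := v.toNormedField
  refine ⟨UniformSpace.Completion A, inferInstance, NormedField.toAbsoluteValue _,
    UniformSpace.Completion.coeRingHom, fun x => UniformSpace.Completion.norm_coe x, ?_, ?_⟩
  · intro s hs
    have hs' : CauchySeq s := Metric.cauchySeq_iff.2 fun ε hε => by
      obtain ⟨N, hN⟩ := hs ε hε
      exact ⟨N, fun m hm n hn => by simpa [dist_eq_norm] using! hN m hm n hn⟩
    obtain ⟨a, ha⟩ := cauchySeq_tendsto_of_complete hs'
    refine ⟨a, fun ε hε => ?_⟩
    obtain ⟨N, hN⟩ := Metric.tendsto_atTop.1 ha ε hε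
    exact ⟨N, fun n hn => by simpa [dist_eq_norm] using! hN n hn⟩
  · intro y ε hε
    obtain ⟨x, hx⟩ := Metric.denseRange_iff.1 UniformSpace.Completion.denseRange_coe y ε hε
    exact ⟨x, by simpa [dist_eq_norm] using! hx⟩

/-- An element whose powers are bounded has absolute value at most one. -/
theorem AbsoluteValue.le_one_of_pow_le {A : Type*} [Field A] (v : AbsoluteValue A ℝ) {x : A}
    (C : ℝ) (h : ∀ n : ℕ, v x ^ n ≤ C) : v x ≤ 1 := by
  by_contra! hx
  obtain ⟨n, hn⟩ := pow_unbounded_of_one_lt C hx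
  exact (h n).not_gt hn

theorem ExtendsAV.le_one_of_isIntegral {A B : Type*} [Field A] [Field B] [Algebra A B]
    {vA : AbsoluteValue A ℝ} {vB : AbsoluteValue B ℝ} (h : ExtendsAV vA vB (algebraMap A B))
    (htriv : ∀ a, a ≠ 0 → vA a = 1) {x : B} (hx : IsIntegral A x) : vB x ≤ 1 := by
  have hle : ∀ a, vA a ≤ 1 := fun a => by
    rcases eq_or_ne a 0 with rfl | ha
    · simp
    · exact (htriv a ha).le
  refine vB.le_one_of_pow_le (∑ i ∈ Finset.range (minpoly A x).natDegree, vB x ^ i) fun n => ?_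
  have hmem : x ^ n = Polynomial.aeval x (Polynomial.X ^ n %ₘ minpoly A x) := by
    rw [Polynomial.aeval_modByMonic_eq_self_of_root (minpoly.aeval A x)]
    simp
  rw [← map_pow, hmem, Polynomial.aeval_eq_sum_range' (n := (minpoly A x).natDegree)]
  · refine (vB.sum_le _ _).trans (Finset.sum_le_sum fun i _ => ?_)
    rw [Algebra.smul_def, map_mul, h, map_pow]
    exact mul_le_of_le_one_left (by positivity) (hle _)
  · exact Polynomial.natDegree_modByMonic_lt _ (minpoly.monic hx) (minpoly.ne_one A x)

/-- An algebraic extension of a trivial absolute value is trivial. -/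
theorem ExtendsAV.eq_one_of_isIntegral {A B : Type*} [Field A] [Field B] [Algebra A B]
    {vA : AbsoluteValue A ℝ} {vB : AbsoluteValue B ℝ} (h : ExtendsAV vA vB (algebraMap A B))
    (htriv : ∀ a, a ≠ 0 → vA a = 1) {x : B} (hx : IsIntegral A x) (hx0 : x ≠ 0) : vB x = 1 := by
  refine le_antisymm (h.le_one_of_isIntegral htriv hx) ?_
  have hinv := h.le_one_of_isIntegral htriv hx.inv
  rw [map_inv₀] at hinv
  exact (inv_le_one₀ (vB.pos hx0)).1 hinv

theorem norm_algHom_eq_of_finiteDimensional {𝕜 E₁ E₂ : Type*} [NontriviallyNormedField 𝕜]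
    [CompleteSpace 𝕜] [NormedField E₁] [NormedField E₂] [NormedAlgebra 𝕜 E₁] [NormedAlgebra 𝕜 E₂]
    [FiniteDimensional 𝕜 E₁] (φ : E₁ →ₐ[𝕜] E₂) (x : E₁) : ‖φ x‖ = ‖x‖ := by
  let T : E₁ →L[𝕜] E₂ := ⟨φ.toLinearMap, φ.toLinearMap.continuous_of_finiteDimensional⟩
  have key : ∀ y : E₁, ‖φ y‖ ≤ ‖y‖ := fun y => by
    rcases eq_or_ne y 0 with rfl | hy
    · simp
    have hy' : 0 < ‖y‖ := norm_pos_iff.2 hy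
    by_contra! hlt
    obtain ⟨n, hn⟩ := pow_unbounded_of_one_lt ‖T‖ ((one_lt_div hy').2 hlt)
    have hT : ‖φ (y ^ n)‖ ≤ ‖T‖ * ‖y ^ n‖ := T.le_opNorm _
    rw [map_pow, norm_pow, norm_pow] at hT
    rw [div_pow, lt_div_iff₀ (by positivity)] at hn
    exact hn.not_ge hT
  refine le_antisymm (key x) ?_
  rcases eq_or_ne x 0 with rfl | hx
  · simp
  have hinv := key x⁻¹
  rw [map_inv₀, norm_inv, norm_inv] at hinv
  exact (inv_le_inv₀ (norm_pos_iff.2 ((map_ne_zero φ).2 hx)) (norm_pos_iff.2 hx)).1 hinv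

theorem finiteDimensional_of_denseRange {k 𝕜 F E : Type*} [Field k] [NontriviallyNormedField 𝕜]
    [CompleteSpace 𝕜] [Field F] [NormedField E] [NormedAlgebra 𝕜 E] [Algebra k F]
    [FiniteDimensional k F] (i : k →+* 𝕜) (j : F →+* E)
    (hij : ∀ x, algebraMap 𝕜 E (i x) = j (algebraMap k F x)) (hj : DenseRange j) :
    FiniteDimensional 𝕜 E := by
  let b := Module.finBasis k F
  let S : Submodule 𝕜 E := Submodule.span 𝕜 (Set.range fun m => j (b m))
  have : FiniteDimensional 𝕜 S := FiniteDimensional.span_of_finite 𝕜 (Set.finite_range _)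
  have hS : ∀ y, j y ∈ S := fun y => by
    rw [← b.sum_repr y, map_sum]
    refine Submodule.sum_mem _ fun m _ => ?_
    rw [Algebra.smul_def, map_mul, ← hij, ← Algebra.smul_def]
    exact S.smul_mem _ (Submodule.subset_span ⟨m, rfl⟩)
  have htop : S = ⊤ := by
    refine eq_top_iff.2 fun y _ => ?_
    exact hj.induction_on (p := fun y => y ∈ S) y S.closed_of_finiteDimensional hS
  exact Module.finite_def.2 (htop ▸ Submodule.fg_span (Set.finite_range _))

/-- The completion of a finite extension is algebraic over the completion of the base, and its
embeddings into any valued extension of the latter are isometric. -/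
theorem IsCompletion.isAlgebraic_and_isometric {k F A B C : Type*} [Field k] [Field F] [Field A]
    [Field B] [Field C] [Algebra k F] [FiniteDimensional k F] [Algebra A B] [Algebra A C]
    {vk : AbsoluteValue k ℝ} {vF : AbsoluteValue F ℝ} {vA : AbsoluteValue A ℝ}
    {vB : AbsoluteValue B ℝ} {vC : AbsoluteValue C ℝ} {i : k →+* A} {j : F →+* B}
    (hi : IsCompletion vk vA i) (hj : IsCompletion vF vB j)
    (hkF : ExtendsAV vk vF (algebraMap k F))
    (hAB : ExtendsAV vA vB (algebraMap A B)) (hAC : ExtendsAV vA vC (algebraMap A C))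
    (hij : ∀ x, algebraMap A B (i x) = j (algebraMap k F x)) :
    Algebra.IsAlgebraic A B ∧ ∀ (φ : B →ₐ[A] C) (y : B), vC (φ y) = vB y := by
  by_cases htriv : ∀ a, a ≠ 0 → vA a = 1
  · have hk : ∀ a, a ≠ 0 → vk a = 1 := fun a ha => by
      rw [← hi.extendsAV, htriv _ ((map_ne_zero i).2 ha)]
    have hsurj : Function.Surjective j := fun y => by
      obtain ⟨x, hx⟩ := hj.dense y (1 / 2) (by norm_num)
      refine ⟨x, ?_⟩
      by_contra hne
      have hpos : 0 < vB (y - j x) := vB.pos (sub_ne_zero.2 (Ne.symm hne))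
      obtain ⟨x', hx'⟩ := hj.dense y (vB (y - j x)) hpos
      have hxx : x' - x ≠ 0 := fun h => by
        rw [sub_eq_zero.1 h] at hx'
        exact lt_irrefl _ hx'
      have h1 : vB (j (x' - x)) = 1 := by
        rw [hj.extendsAV]
        exact hkF.eq_one_of_isIntegral hk (Algebra.IsIntegral.isIntegral _) hxx
      have h2 : vB (j (x' - x)) ≤ vB (y - j x) + vB (y - j x') := by
        rw [vB.map_sub y (j x')]
        refine le_trans (le_of_eq ?_) (vB.add_le _ _)
        congr 1
        rw [map_sub]
        ring
      linarith
    have hint : ∀ y : B, IsIntegral A y := fun y => by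
      obtain ⟨x, rfl⟩ := hsurj y
      exact (Algebra.IsIntegral.isIntegral (R := k) x).map_of_comp_eq i j (RingHom.ext hij)
    refine ⟨⟨fun y => (hint y).isAlgebraic⟩, fun φ y => ?_⟩
    rcases eq_or_ne y 0 with rfl | hy
    · simp
    · rw [hAB.eq_one_of_isIntegral htriv (hint y) hy,
        hAC.eq_one_of_isIntegral htriv ((hint y).map φ) ((map_ne_zero φ).2 hy)]
  · push Not at htriv
    let : NormedField A := vA.toNormedField
    let : NontriviallyNormedField A := NontriviallyNormedField.ofNormNeOne htriv
    let : NormedField B := vB.toNormedField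
    let : NormedField C := vC.toNormedField
    have : CompleteSpace A := hi.complete.completeSpace
    let : NormedAlgebra A B :=
      { (inferInstance : Algebra A B) with
        norm_smul_le := fun a b => by
          rw [Algebra.smul_def, norm_mul]
          exact (congrArg (· * ‖b‖) (hAB a)).le }
    let : NormedAlgebra A C :=
      { (inferInstance : Algebra A C) with
        norm_smul_le := fun a b => by
          rw [Algebra.smul_def, norm_mul]
          exact (congrArg (· * ‖b‖) (hAC a)).le }
    have hfin : FiniteDimensional A B :=
      finiteDimensional_of_denseRange (k := k) i j hij hj.denseRange
    exact ⟨Algebra.IsAlgebraic.of_finite A B,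
      fun φ y => norm_algHom_eq_of_finiteDimensional φ y⟩

/-- **Lemma (surjectivity of Φ).**
In the setting of the local theorem, with `vMa` the (unique) absolute value on `M̂ᵃ`
extending that of `M̂`:  every absolute value `w` on `F` extending both `vL` and `vM` is the
pullback of `vMa` along some `M`-algebra embedding `α : F → M̂ᵃ` belonging to `ℰ`. -/
theorem local_Phi_surjective
    {K L M F : Type*} [Field K] [Field L] [Field M] [Field F]
    [Algebra K L] [Algebra K M] [Algebra K F] [Algebra L F] [Algebra M F]
    [IsScalarTower K L F] [IsScalarTower K M F]
    [FiniteDimensional K L] [FiniteDimensional M F]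
    (vK : AbsoluteValue K ℝ) (vL : AbsoluteValue L ℝ) (vM : AbsoluteValue M ℝ)
    (hvL : ExtendsAV vK vL (algebraMap K L)) (hvM : ExtendsAV vK vM (algebraMap K M))
    -- the completions `K̂`, `L̂`, `M̂`
    {Kh Lh Mh : Type*} [Field Kh] [Field Lh] [Field Mh]
    [Algebra K Kh] [Algebra L Lh] [Algebra M Mh]
    [Algebra Kh Lh] [Algebra Kh Mh] [Algebra K Lh] [Algebra K Mh]
    [IsScalarTower K Kh Lh] [IsScalarTower K L Lh]
    [IsScalarTower K Kh Mh] [IsScalarTower K M Mh]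
    (vKh : AbsoluteValue Kh ℝ) (vLh : AbsoluteValue Lh ℝ) (vMh : AbsoluteValue Mh ℝ)
    (hKh : IsCompletion vK vKh (algebraMap K Kh))
    (hLh : IsCompletion vL vLh (algebraMap L Lh))
    (hMh : IsCompletion vM vMh (algebraMap M Mh))
    (hKhLh : ExtendsAV vKh vLh (algebraMap Kh Lh))
    (hKhMh : ExtendsAV vKh vMh (algebraMap Kh Mh))
    -- an algebraic closure `M̂ᵃ` of `M̂`
    {Ma : Type*} [Field Ma] [Algebra Mh Ma] [IsAlgClosure Mh Ma]
    [Algebra Kh Ma] [IsScalarTower Kh Mh Ma]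
    [Algebra M Ma] [IsScalarTower M Mh Ma]
    (vMa : AbsoluteValue Ma ℝ) (hvMa : ExtendsAV vMh vMa (algebraMap Mh Ma)) :
    ∀ w : AbsoluteValue F ℝ,
      ExtendsAV vL w (algebraMap L F) → ExtendsAV vM w (algebraMap M F) →
      ∃ α : F →ₐ[M] Ma,
        (∃ γ : Lh →ₐ[Kh] Ma, ∀ x : L, α (algebraMap L F x) = γ (algebraMap L Lh x)) ∧
        ∀ y : F, vMa (α y) = w y := by
  intro w hwL hwM
  obtain ⟨Fh, _, vFh, j, hj⟩ := exists_isCompletion w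
  obtain ⟨μ, hμ, hμM⟩ := hMh.exists_extension hj.complete (hwM.comap_comp hj.extendsAV)
  obtain ⟨lam, hlam, hlamL⟩ := hLh.exists_extension hj.complete (hwL.comap_comp hj.extendsAV)
  let : Algebra Mh Fh := μ.toAlgebra
  obtain ⟨halg, hiso⟩ :=
    hMh.isAlgebraic_and_isometric hj hwM (vB := vFh) (vC := vMa) hμ hvMa hμM
  have : IsAlgClosed Ma := IsAlgClosure.isAlgClosed Mh
  have : Module.IsTorsionFree Mh Fh := Module.IsTorsionFree.of_smul_eq_zero fun a y h => by
    rw [Algebra.smul_def, mul_eq_zero] at h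
    exact h.imp_left (map_eq_zero μ).1
  let σ : Fh →ₐ[Mh] Ma := IsAlgClosed.lift
  have hKhFh : ∀ x : Kh, lam (algebraMap Kh Lh x) = μ (algebraMap Kh Mh x) :=
    hKh.ringHom_ext (hKhLh.comap_comp hlam) (hKhMh.comap_comp hμ) fun x => by
      simp only [RingHom.comp_apply]
      rw [← IsScalarTower.algebraMap_apply K Kh Lh, ← IsScalarTower.algebraMap_apply K Kh Mh,
        IsScalarTower.algebraMap_apply K L Lh, IsScalarTower.algebraMap_apply K M Mh, hlamL, hμM,
        RingHom.comp_apply, RingHom.comp_apply, ← IsScalarTower.algebraMap_apply K L F,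
        ← IsScalarTower.algebraMap_apply K M F]
  refine ⟨{ σ.toRingHom.comp j with commutes' := fun x => ?_ },
    ⟨{ σ.toRingHom.comp lam with commutes' := fun x => ?_ }, fun x => ?_⟩, fun y => ?_⟩
  · change σ (j (algebraMap M F x)) = algebraMap M Ma x
    rw [IsScalarTower.algebraMap_apply M Mh Ma, ← σ.commutes]
    exact congrArg σ (hμM x).symm
  · change σ (lam (algebraMap Kh Lh x)) = algebraMap Kh Ma x
    rw [IsScalarTower.algebraMap_apply Kh Mh Ma, ← σ.commutes]
    exact congrArg σ (hKhFh x)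
  · exact congrArg σ (hlamL x).symm
  · exact (hiso σ (j y)).trans (hj.extendsAV y)
end
end

section
/- Every place Q of any F_i lying over both P and R satisfies e(Q/S) = lcm(e(P/S), e(R/S)). -/
open scoped TensorProduct

noncomputable section

/-- `K` is the function field of a curve over `k`: a finitely generated field extension of
`k` of transcendence degree `1` (finite over `k(x)` for some transcendental `x`), whose
field of constants is `k` itself. -/
def IsFunctionFieldOver (k K : Type*) [Field k] [Field K] [Algebra k K] : Prop :=
  (∃ x : K, Transcendental k x ∧
    FiniteDimensional ↥(IntermediateField.adjoin k {x}) K) ∧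
  (∀ x : K, IsAlgebraic k x → x ∈ (algebraMap k K).range)

/-- A place of a function field `K/k`: a normalized (i.e. surjective onto `ℤₘ₀`) discrete
valuation which is trivial on the constant field `k`. -/
def IsPlace {k K : Type*} [Field k] [Field K] [Algebra k K]
    (w : Valuation K (WithZero (Multiplicative ℤ))) : Prop :=
  Function.Surjective w ∧ ∀ c : k, c ≠ 0 → w (algebraMap k K c) = 1

/-- The place `w` of `F` lies over the place `v` of `K` (along the embedding `f : K → F`)
with ramification index `e`. -/
def LiesOverE {K F : Type*} [Field K] [Field F]
    (w : Valuation F (WithZero (Multiplicative ℤ))) (f : K →+* F)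
    (v : Valuation K (WithZero (Multiplicative ℤ))) (e : ℕ) : Prop :=
  0 < e ∧ ∀ x : K, w (f x) = (v x) ^ e

/-- The place `w` of `F` lies over the place `v` of `K` (along the embedding `f : K → F`). -/
def LiesOver {K F : Type*} [Field K] [Field F]
    (w : Valuation F (WithZero (Multiplicative ℤ))) (f : K →+* F)
    (v : Valuation K (WithZero (Multiplicative ℤ))) : Prop :=
  ∃ e : ℕ, LiesOverE w f v e

open WithZero Polynomial

section Residue

variable {k F : Type*} [Field k] [Field F] [Algebra k F] {w : Valuation F ℤᵐ⁰}

lemma valuation_const_le_one (hw : ∀ c : k, c ≠ 0 → w (algebraMap k F c) = 1) (c : k) :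
    w (algebraMap k F c) ≤ 1 := by
  rcases eq_or_ne c 0 with rfl | hc
  · simp
  · exact (hw c hc).le

lemma exists_residue_of_aeval_lt_one [IsAlgClosed k]
    (hw : ∀ c : k, c ≠ 0 → w (algebraMap k F c) = 1) {f : F} {p : k[X]} (hp : p ≠ 0)
    (h : w (aeval f p) < 1) : ∃ c : k, w (f - algebraMap k F c) < 1 := by
  have key : ∀ s : Multiset k, w (s.map fun c ↦ f - algebraMap k F c).prod < 1 →
      ∃ c : k, w (f - algebraMap k F c) < 1 := by
    intro s
    induction s using Multiset.induction with
    | empty => simp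
    | cons c s ih =>
      intro hs
      by_contra! hcon
      rw [Multiset.map_cons, Multiset.prod_cons, map_mul] at hs
      obtain ⟨d, hd⟩ := ih ((le_mul_of_one_le_left' (hcon c)).trans_lt hs)
      exact (hcon d).not_gt hd
  rw [(IsAlgClosed.splits p).eq_prod_roots, map_mul, aeval_C, map_mul,
    hw _ (leadingCoeff_ne_zero.mpr hp), one_mul, map_multiset_prod, Multiset.map_map] at h
  refine key p.roots ?_
  simpa [Function.comp_def] using h

open scoped IntermediateField.algebraAdjoinAdjoin in
lemma trdeg_le_one_of_isFunctionFieldOver (hF : IsFunctionFieldOver k F) :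
    Algebra.trdeg k F ≤ 1 := by
  obtain ⟨⟨x, -, hfin⟩, -⟩ := hF
  have h1 : Algebra.IsAlgebraic (IntermediateField.adjoin k {x}) F := inferInstance
  have h2 : Algebra.IsAlgebraic (Algebra.adjoin k {x}) F :=
    (IsFractionRing.comap_isAlgebraic_iff (A := Algebra.adjoin k {x})
      (K := IntermediateField.adjoin k {x})).mpr h1
  simpa using Algebra.IsAlgebraic.trdeg_le_cardinalMk k ({x} : Set F)

/-- Two elements of a function field of a curve are algebraically dependent. -/
lemma exists_bivariate_ne_zero (hF : IsFunctionFieldOver k F) (x y : F) :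
    ∃ p : k[X][X], p ≠ 0 ∧ aevalAeval x y p = 0 := by
  by_contra! hcon
  have hinj : Function.Injective (aevalAeval x y : k[X][X] →ₐ[k] F) :=
    (injective_iff_map_eq_zero _).mpr fun p hp ↦ by_contra fun h ↦ hcon p h hp
  have h1 := lift_trdeg_le_of_injective _ hinj
  have h2 := trdeg_add_eq k k[X] (A := k[X][X])
  rw [Polynomial.trdeg_of_isDomain, Polynomial.trdeg_of_isDomain] at h2
  have h3 := Cardinal.lift_le.mpr (trdeg_le_one_of_isFunctionFieldOver hF)
  have h4 := h1.trans h3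
  rw [← h2] at h4
  norm_num at h4

/-- The residue field at a place of a function field is the field of constants. -/
lemma exists_residue [IsAlgClosed k] (hF : IsFunctionFieldOver k F) (hw : IsPlace (k := k) w)
    {f : F} (hf : w f ≤ 1) : ∃ c : k, w (f - algebraMap k F c) < 1 := by
  obtain ⟨hsurj, hw⟩ := hw
  obtain ⟨y, hy⟩ := hsurj (exp (-1))
  have hy0 : y ≠ 0 := by rintro rfl; rw [map_zero] at hy; exact exp_ne_zero hy.symm
  have hy1 : w y < 1 := by rw [hy, ← exp_zero, exp_lt_exp]; norm_num
  obtain ⟨p, hp0, hp⟩ := exists_bivariate_ne_zero hF y f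
  have hprime : Prime (C X : k[X][X]) := prime_C_iff.mpr prime_X
  obtain ⟨n, q, hq, rfl⟩ := WfDvdMonoid.max_power_factor hp0 hprime.irreducible
  have hq0 : aevalAeval y f q = 0 := by
    rw [map_mul, map_pow, aevalAeval_X] at hp
    exact (mul_eq_zero.mp hp).resolve_left (pow_ne_zero _ hy0)
  have hconst (g : k[X]) : w (aeval y g - algebraMap k F (g.coeff 0)) < 1 := by
    have : aeval y g = aeval y g.divX * y + algebraMap k F (g.coeff 0) := by
      conv_lhs => rw [← divX_mul_X_add g]
      simp
    rw [this, add_sub_cancel_right, map_mul]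
    refine Right.mul_lt_one_of_le_of_lt ?_ hy1
    rw [aeval_eq_sum_range]
    refine w.map_sum_le fun i _ ↦ ?_
    rw [Algebra.smul_def, map_mul, map_pow]
    exact mul_le_one' (valuation_const_le_one hw _) (pow_le_one' hy1.le _)
  have hr : q.map constantCoeff ≠ 0 := by
    intro h
    apply hq
    rw [C_dvd_iff_dvd_coeff]
    intro i
    rw [X_dvd_iff]
    simpa using congrArg (fun r ↦ r.coeff i) h
  refine exists_residue_of_aeval_lt_one hw hr ?_
  have h1 : aevalAeval y f q = ∑ i ∈ Finset.range (q.natDegree + 1), aeval y (q.coeff i) * f ^ i := by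
    conv_lhs => rw [q.as_sum_range_C_mul_X_pow]
    simp
  have h2 : aeval f (q.map constantCoeff) =
      ∑ i ∈ Finset.range (q.natDegree + 1), algebraMap k F ((q.coeff i).coeff 0) * f ^ i := by
    conv_lhs => rw [q.as_sum_range_C_mul_X_pow]
    simp [Polynomial.map_sum]
  rw [← sub_zero (aeval f _), ← hq0, h1, h2, ← Finset.sum_sub_distrib]
  refine w.map_sum_lt one_ne_zero fun i _ ↦ ?_
  rw [← sub_mul, map_mul, map_pow, Valuation.map_sub_swap]
  exact mul_lt_one_of_nonneg_of_lt_one_left zero_le (hconst _) (pow_le_one' hf _)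

end Residue

section Approximation

variable {F : Type*} [Field F] {w : Valuation F ℤᵐ⁰}

lemma lt_one_iff_le_exp_neg_one {x : ℤᵐ⁰} : x < 1 ↔ x ≤ exp (-1) := by
  rw [← lt_mul_exp_iff_le exp_ne_zero, ← exp_add]
  simp

lemma exp_pow_int (n : ℤ) (m : ℕ) : (exp n : ℤᵐ⁰) ^ m = exp (m * n) := by
  rw [← exp_nsmul, nsmul_eq_mul]

lemma valuation_natCast_eq_one {k : Type*} [Field k] [Algebra k F]
    (hw : ∀ c : k, c ≠ 0 → w (algebraMap k F c) = 1) {n : ℕ} (hn : ¬ ringChar k ∣ n) :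
    w (n : F) = 1 := by
  rw [← map_natCast (algebraMap k F)]
  exact hw _ fun h ↦ hn ((ringChar.spec k n).mp h)

lemma exists_add_pow_eq {x y : F} (hx : w x ≤ 1) (hy : w y ≤ 1) (n : ℕ) :
    ∃ z, w z ≤ 1 ∧ (x + y) ^ n = x ^ n + n * x ^ (n - 1) * y + z * y ^ 2 := by
  obtain ⟨z, hz⟩ := powAddExpansion (⟨x, hx⟩ : w.integer) ⟨y, hy⟩ n
  exact ⟨z, z.2, by simpa using congrArg (Subtype.val) hz⟩

lemma valuation_pow_sub_pow_le {x y : F} (hx : w x ≤ 1) (hy : w y ≤ 1) (n : ℕ) :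
    w (x ^ n - y ^ n) ≤ w (x - y) := by
  rw [← geom_sum₂_mul, map_mul]
  refine mul_le_of_le_one_left' (w.map_sum_le fun i _ ↦ ?_)
  rw [map_mul, map_pow, map_pow]
  exact mul_le_one' (pow_le_one' hx _) (pow_le_one' hy _)

lemma valuation_pow_sub_pow_eq {n : ℕ} (hn : w (n : F) = 1) {x y : F} (hy : w y = 1)
    (hxy : w (x - y) < 1) : w (x ^ n - y ^ n) = w (x - y) := by
  obtain ⟨z, hz, h⟩ := exists_add_pow_eq hy.le hxy.le n
  have hfac : x ^ n - y ^ n = (n * y ^ (n - 1) + z * (x - y)) * (x - y) := by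
    rw [add_sub_cancel] at h
    rw [h]
    ring
  have hunit : w (n * y ^ (n - 1)) = 1 := by simp [hn, hy]
  rw [hfac, map_mul, w.map_add_eq_of_lt_left, hunit, one_mul]
  rw [hunit, map_mul]
  exact Right.mul_lt_one_of_le_of_lt hz hxy

lemma exists_approx_root {n : ℕ} (hn : w (n : F) = 1) {u c : F} (hu : w u = 1)
    (hc : w (c ^ n - u) < 1) (N : ℕ) :
    ∃ y, w y = 1 ∧ w (y - c) < 1 ∧ w (y ^ n - u) ≤ exp (-(N : ℤ)) := by
  have hn0 : n ≠ 0 := by rintro rfl; simp at hn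
  have hc1 : w c = 1 := by
    have : w (c ^ n) = 1 := by
      rw [← sub_add_cancel (c ^ n) u, w.map_add_eq_of_lt_right (hu ▸ hc), hu]
    rw [map_pow] at this
    exact (pow_eq_one_iff.mp this).resolve_right hn0
  suffices h : ∃ y, w y = 1 ∧ w (y - c) < 1 ∧ w (y ^ n - u) ≤ exp (-((N : ℤ) + 1)) by
    obtain ⟨y, h1, h2, h3⟩ := h
    exact ⟨y, h1, h2, h3.trans (exp_le_exp.mpr (by lia))⟩
  induction N with
  | zero => exact ⟨c, hc1, by simp, by simpa using lt_one_iff_le_exp_neg_one.mp hc⟩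
  | succ N ih =>
    obtain ⟨y, hy, hyc, hyu⟩ := ih
    have hunit : w (n * y ^ (n - 1)) = 1 := by simp [hn, hy]
    have hne : (n * y ^ (n - 1) : F) ≠ 0 := fun h ↦ by simp [h] at hunit
    set δ : F := -((y ^ n - u) / (n * y ^ (n - 1))) with hδ
    have hwδ : w δ ≤ exp (-((N : ℤ) + 1)) := by
      rw [hδ, Valuation.map_neg, map_div₀, hunit, div_one]
      exact hyu
    have hδ1 : w δ < 1 := lt_one_iff_le_exp_neg_one.mpr (hwδ.trans (exp_le_exp.mpr (by lia)))
    obtain ⟨z, hz, h⟩ := exists_add_pow_eq hy.le hδ1.le n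
    refine ⟨y + δ, ?_, ?_, ?_⟩
    · rw [w.map_add_eq_of_lt_left (hy ▸ hδ1), hy]
    · rw [add_sub_right_comm]
      exact w.map_add_lt hyc hδ1
    · have : (y + δ) ^ n - u = z * δ ^ 2 := by
        have hlin : n * y ^ (n - 1) * δ = -(y ^ n - u) := by
          rw [hδ, mul_neg, mul_div_cancel₀ _ hne]
        rw [h, hlin]
        ring
      rw [this, map_mul, map_pow]
      refine (mul_le_of_le_one_left' hz).trans ((pow_le_pow_left' hwδ 2).trans ?_)
      rw [exp_pow_int, exp_le_exp]
      push_cast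
      lia

lemma exists_valuation_sum_eq {ι : Type*} (s : Finset ι) (f : ι → F)
    (hf : ∀ i ∈ s, ∀ j ∈ s, i ≠ j → f i ≠ 0 → w (f i) ≠ w (f j)) (h : ∑ i ∈ s, f i ≠ 0) :
    ∃ i ∈ s, f i ≠ 0 ∧ w (∑ i ∈ s, f i) = w (f i) := by
  classical
  induction s using Finset.induction_on with
  | empty => simp at h
  | insert a s ha ih =>
    have ih := ih fun i hi j hj ↦
      hf i (Finset.mem_insert_of_mem hi) j (Finset.mem_insert_of_mem hj)
    rw [Finset.sum_insert ha] at h ⊢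
    by_cases h0 : ∑ i ∈ s, f i = 0
    · rw [h0, add_zero] at h ⊢
      exact ⟨a, Finset.mem_insert_self _ _, h, rfl⟩
    obtain ⟨i, hi, hi0, hw⟩ := ih h0
    have hne : w (f a) ≠ w (∑ i ∈ s, f i) := by
      rw [hw]
      exact (hf i (Finset.mem_insert_of_mem hi) a (Finset.mem_insert_self _ _)
        (fun h ↦ ha (h ▸ hi)) hi0).symm
    rw [w.map_add_of_distinct_val hne]
    rcases le_total (w (f a)) (w (∑ i ∈ s, f i)) with hle | hle
    · exact ⟨i, Finset.mem_insert_of_mem hi, hi0, by rw [max_eq_right hle, hw]⟩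
    · refine ⟨a, Finset.mem_insert_self _ _, ?_, max_eq_left hle⟩
      rintro ha0
      rw [ha0, map_zero] at hle
      exact h0 ((map_eq_zero w).mp (le_antisymm hle zero_le))

end Approximation

/-- A uniformizer at a place can be chosen so that its `n`-th power approximates a given element of
order `n`, provided `n` is prime to the characteristic. -/
lemma exists_uniformizer_pow_sub_le {k L : Type*} [Field k] [IsAlgClosed k] [Field L] [Algebra k L]
    {P : Valuation L ℤᵐ⁰} (hL : IsFunctionFieldOver k L) (hP : IsPlace (k := k) P)
    {n : ℕ} (hn : ¬ ringChar k ∣ n) {t : L} (ht : P t = exp (-(n : ℤ))) (N : ℕ) :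
    ∃ ϖ : L, P ϖ = exp (-1) ∧ P (ϖ ^ n - t) ≤ exp (-(N : ℤ)) * exp (-(n : ℤ)) := by
  have hn0 : n ≠ 0 := fun h ↦ by simp [h] at hn
  obtain ⟨ϖ₀, hϖ₀⟩ := hP.1 (exp (-1))
  have hϖ₀n : P (ϖ₀ ^ n) = exp (-(n : ℤ)) := by
    rw [map_pow, hϖ₀, exp_pow_int, mul_neg_one]
  have hϖ₀ne : ϖ₀ ^ n ≠ 0 := by
    rw [← P.ne_zero_iff, hϖ₀n]
    exact exp_ne_zero
  have hu : P (t / ϖ₀ ^ n) = 1 := by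
    rw [map_div₀, ht, hϖ₀n, div_self exp_ne_zero]
  obtain ⟨c₀, hc₀⟩ := exists_residue hL hP hu.le
  obtain ⟨c₁, rfl⟩ := IsAlgClosed.exists_pow_nat_eq c₀ (Nat.pos_of_ne_zero hn0)
  rw [Valuation.map_sub_swap, map_pow] at hc₀
  obtain ⟨y, hy, -, hyu⟩ := exists_approx_root (valuation_natCast_eq_one hP.2 hn) hu hc₀ N
  refine ⟨y * ϖ₀, by rw [map_mul, hy, one_mul, hϖ₀], ?_⟩
  have : (y * ϖ₀) ^ n - t = (y ^ n - t / ϖ₀ ^ n) * ϖ₀ ^ n := by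
    rw [sub_mul, div_mul_cancel₀ _ hϖ₀ne, mul_pow]
  rw [this, map_mul, hϖ₀n]
  exact mul_le_mul_left hyu _

section Compositum

variable {L M F : Type*} [Field L] [Field M] [Field F] [Algebra L F] [Algebra M F]
  {P : Valuation L ℤᵐ⁰} {R : Valuation M ℤᵐ⁰} {Q : Valuation F ℤᵐ⁰} {p r : ℕ}

/-- If `P` is tame, some uniformizer of `P` has its `a`-th power close to an element of `M`, where
`a` is the numerator of `e(P/S) / e(R/S)`. -/
lemma exists_uniformizer_pow_approx {k : Type*} [Field k] [IsAlgClosed k] [Algebra k L]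
    [Algebra k M] [Algebra k F] [IsScalarTower k L F] [IsScalarTower k M F]
    (hL : IsFunctionFieldOver k L) (hM : IsFunctionFieldOver k M)
    (hP : IsPlace (k := k) P) (hR : IsPlace (k := k) R) (hQ : IsPlace (k := k) Q)
    (hPQ : LiesOverE Q (algebraMap L F) P p) (hRQ : LiesOverE Q (algebraMap M F) R r)
    {a b d : ℕ} (had : ¬ ringChar k ∣ a * d) (hab : p * a = r * b) {tL : L} {tM : M}
    (ht : algebraMap L F tL = algebraMap M F tM)
    (htL : P tL = exp (-((a * d : ℕ) : ℤ))) (htM : R tM = exp (-((b * d : ℕ) : ℤ))) (N : ℕ) :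
    ∃ (ϖ : L) (μ : M), P ϖ = exp (-1) ∧ R μ ≤ 1 ∧
      Q (algebraMap L F ϖ ^ a - algebraMap M F μ) ≤ exp (-(N : ℤ)) := by
  obtain ⟨hp, hPQ⟩ := hPQ
  obtain ⟨hr, hRQ⟩ := hRQ
  have hd : ¬ ringChar k ∣ d := fun h ↦ had (h.mul_left a)
  have hd0 : d ≠ 0 := by rintro rfl; simp at hd
  obtain ⟨ϖ, hϖ, hϖt⟩ := exists_uniformizer_pow_sub_le hL hP had htL (N + 1)
  obtain ⟨s, hs⟩ := hR.1 (exp (-1))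
  have hs0 : s ≠ 0 := by
    rw [← R.ne_zero_iff, hs]
    exact exp_ne_zero
  have hsF : algebraMap M F s ≠ 0 := by simpa using hs0
  have hv : R (tM / s ^ (b * d)) = 1 := by
    rw [map_div₀, map_pow, hs, htM, exp_pow_int, mul_neg_one, div_self exp_ne_zero]
  set v := tM / s ^ (b * d) with hv_def
  set ξ : F := algebraMap L F ϖ ^ a / algebraMap M F s ^ b with hξ_def
  have hξ : Q ξ = 1 := by
    rw [hξ_def, map_div₀, map_pow, map_pow, hPQ, hRQ, hϖ, hs, ← pow_mul, ← pow_mul, hab,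
      div_self (pow_ne_zero _ exp_ne_zero)]
  have hξv : Q (ξ ^ d - algebraMap M F v) ≤ exp (-((N + 1 : ℕ) : ℤ)) := by
    have h1 : ξ ^ d - algebraMap M F v =
        algebraMap L F (ϖ ^ (a * d) - tL) / algebraMap M F (s ^ (b * d)) := by
      rw [hξ_def, hv_def, map_sub, map_div₀, ← ht, div_pow, ← pow_mul, ← pow_mul, sub_div, map_pow,
        map_pow]
    rw [h1, map_div₀, hPQ, hRQ, map_pow, hs]
    refine (div_le_div_of_nonneg_right (pow_le_pow_left' hϖt p) zero_le).trans ?_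
    rw [← exp_add, exp_pow_int, exp_pow_int, exp_pow_int, ← exp_sub, exp_le_exp]
    have h2 : (p : ℤ) * (a * d) = r * (b * d) := by
      rw [← mul_assoc, ← mul_assoc]
      exact_mod_cast congrArg (· * d) hab
    have h3 : (N + 1 : ℤ) ≤ p * (N + 1) := le_mul_of_one_le_left (by lia) (by exact_mod_cast hp)
    push_cast
    linarith
  have hξv1 : Q (ξ ^ d - algebraMap M F v) < 1 :=
    lt_one_iff_le_exp_neg_one.mpr (hξv.trans (exp_le_exp.mpr (by lia)))
  -- the residue of `ξ`
  obtain ⟨c₂, hc₂⟩ := exists_residue hM hR hv.le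
  have hc₂F : Q (algebraMap M F v - algebraMap k F c₂) < 1 := by
    rw [IsScalarTower.algebraMap_apply k M F, ← map_sub, hRQ]
    exact pow_lt_one₀ zero_le hc₂ hr.ne'
  obtain ⟨c, hc⟩ : ∃ c : k, Q (ξ - algebraMap k F c) < 1 := by
    refine exists_residue_of_aeval_lt_one hQ.2 (X_pow_sub_C_ne_zero (Nat.pos_of_ne_zero hd0) c₂) ?_
    rw [map_sub, map_pow, aeval_X, aeval_C, ← sub_add_sub_cancel _ (algebraMap M F v)]
    exact Q.map_add_lt hξv1 hc₂F
  have hcv : R (algebraMap k M c ^ d - v) < 1 := by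
    rw [← pow_lt_one_iff_of_nonneg zero_le hr.ne', ← hRQ, map_sub, map_pow,
      ← IsScalarTower.algebraMap_apply, ← sub_add_sub_cancel _ (ξ ^ d)]
    refine Q.map_add_lt ?_ hξv1
    refine (valuation_pow_sub_pow_le (valuation_const_le_one hQ.2 c) hξ.le d).trans_lt ?_
    rwa [Valuation.map_sub_swap]
  obtain ⟨z, hz, hzc, hzv⟩ :=
    exists_approx_root (valuation_natCast_eq_one hR.2 hd) hv hcv (N + 1)
  have hzF : Q (algebraMap M F z) = 1 := by rw [hRQ, hz, one_pow]
  have hξz : Q (ξ - algebraMap M F z) < 1 := by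
    rw [← sub_sub_sub_cancel_right _ _ (algebraMap k F c)]
    refine Q.map_sub_lt hc ?_
    rw [IsScalarTower.algebraMap_apply k M F, ← map_sub, hRQ]
    exact pow_lt_one₀ zero_le hzc hr.ne'
  have hξz' : Q (ξ - algebraMap M F z) ≤ exp (-(N : ℤ)) := by
    rw [← valuation_pow_sub_pow_eq (valuation_natCast_eq_one hQ.2 hd) hzF hξz,
      ← sub_sub_sub_cancel_right _ _ (algebraMap M F v)]
    refine (Q.map_sub_le hξv ?_).trans (exp_le_exp.mpr (by lia : -((N + 1 : ℕ) : ℤ) ≤ -(N : ℤ)))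
    rw [← map_pow, ← map_sub, hRQ]
    refine (pow_le_of_le_one zero_le ?_ hr.ne').trans hzv
    exact hzv.trans (by rw [← exp_zero, exp_le_exp]; lia)
  refine ⟨ϖ, z * s ^ b, hϖ, ?_, ?_⟩
  · rw [map_mul, hz, one_mul, map_pow, hs, exp_pow_int, ← exp_zero, exp_le_exp]
    lia
  · have : algebraMap L F ϖ ^ a - algebraMap M F (z * s ^ b) =
        (ξ - algebraMap M F z) * algebraMap M F (s ^ b) := by
      rw [sub_mul, hξ_def, map_mul, map_pow, div_mul_cancel₀ _ (pow_ne_zero _ hsF)]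
    rw [this, map_mul]
    refine (mul_le_of_le_one_right' ?_).trans hξz'
    rw [hRQ, map_pow, hs, ← pow_mul, exp_pow_int, ← exp_zero, exp_le_exp]
    lia

/-- `x` agrees to precision `N` with an `M`-linear combination of `1, ϖ, …, ϖ ^ (a - 1)`. -/
def IsApproxBy (M : Type*) {F : Type*} [Field M] [Field F] [Algebra M F] (Q : Valuation F ℤᵐ⁰)
    (ϖ : F) (a N : ℕ) (x : F) : Prop :=
  ∃ m : ℕ → M, Q (x - ∑ i ∈ Finset.range a, algebraMap M F (m i) * ϖ ^ i) ≤ exp (-(N : ℤ))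

namespace IsApproxBy

variable {ϖ : F} {a N : ℕ} {x y : F}

lemma of_le (h : Q x ≤ exp (-(N : ℤ))) : IsApproxBy M Q ϖ a N x := ⟨0, by simpa using h⟩

lemma add (hx : IsApproxBy M Q ϖ a N x) (hy : IsApproxBy M Q ϖ a N y) :
    IsApproxBy M Q ϖ a N (x + y) := by
  obtain ⟨m, hm⟩ := hx
  obtain ⟨m', hm'⟩ := hy
  refine ⟨m + m', ?_⟩
  convert Q.map_add_le hm hm' using 2
  simp only [Pi.add_apply, map_add, add_mul, Finset.sum_add_distrib]
  ring

lemma algebraMap_mul {c : M} (hc : Q (algebraMap M F c) ≤ 1) (hx : IsApproxBy M Q ϖ a N x) :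
    IsApproxBy M Q ϖ a N (algebraMap M F c * x) := by
  obtain ⟨m, hm⟩ := hx
  refine ⟨fun i ↦ c * m i, ?_⟩
  have : algebraMap M F c * x - ∑ i ∈ Finset.range a, algebraMap M F (c * m i) * ϖ ^ i =
      algebraMap M F c * (x - ∑ i ∈ Finset.range a, algebraMap M F (m i) * ϖ ^ i) := by
    simp only [mul_sub, Finset.mul_sum, map_mul, mul_assoc]
  rw [this, map_mul]
  exact (mul_le_of_le_one_left' hc).trans hm

lemma pow (ha : 0 < a) {μ : M} (hϖ : Q ϖ ≤ 1) (hμ : Q (algebraMap M F μ) ≤ 1)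
    (h : Q (ϖ ^ a - algebraMap M F μ) ≤ exp (-(N : ℤ))) (j : ℕ) :
    IsApproxBy M Q ϖ a N (ϖ ^ j) := by
  refine ⟨Pi.single (j % a) (μ ^ (j / a)), ?_⟩
  rw [Finset.sum_eq_single_of_mem (j % a) (Finset.mem_range.mpr (Nat.mod_lt j ha))
    fun i _ hi ↦ by simp [hi], Pi.single_eq_same]
  nth_rewrite 1 [← Nat.div_add_mod j a]
  rw [pow_add, pow_mul, ← sub_mul, map_mul, map_pow, map_pow Q]
  refine (mul_le_of_le_one_right' (pow_le_one' hϖ _)).trans (le_trans ?_ h)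
  exact valuation_pow_sub_pow_le (by rw [map_pow]; exact pow_le_one' hϖ a) hμ _

end IsApproxBy

lemma isApproxBy_algebraMap {k : Type*} [Field k] [IsAlgClosed k] [Algebra k L]
    [Algebra k M] [Algebra k F] [IsScalarTower k L F] [IsScalarTower k M F]
    (hL : IsFunctionFieldOver k L) (hP : IsPlace (k := k) P) (hQ : IsPlace (k := k) Q)
    (hPQ : LiesOverE Q (algebraMap L F) P p) {a N : ℕ} (ha : 0 < a) {ϖ : L} {μ : M}
    (hϖ : P ϖ = exp (-1)) (hμ : Q (algebraMap M F μ) ≤ 1)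
    (h : Q (algebraMap L F ϖ ^ a - algebraMap M F μ) ≤ exp (-(N : ℤ)))
    {l : L} (hl : P l ≤ 1) : IsApproxBy M Q (algebraMap L F ϖ) a N (algebraMap L F l) := by
  obtain ⟨hp, hPQ⟩ := hPQ
  have hϖ0 : ϖ ≠ 0 := by
    rw [← P.ne_zero_iff, hϖ]
    exact exp_ne_zero
  have hϖF : Q (algebraMap L F ϖ) ≤ 1 := by
    rw [hPQ, hϖ, exp_pow_int, ← exp_zero, exp_le_exp]
    lia
  have key (n : ℕ) : ∃ g : L, IsApproxBy M Q (algebraMap L F ϖ) a N (algebraMap L F g) ∧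
      P (l - g) ≤ exp (-(n : ℤ)) := by
    induction n with
    | zero => exact ⟨0, .of_le (by simp), by simpa using hl⟩
    | succ n ih =>
      obtain ⟨g, hg, hlg⟩ := ih
      have hϖn : P (ϖ ^ n) = exp (-(n : ℤ)) := by rw [map_pow, hϖ, exp_pow_int, mul_neg_one]
      obtain ⟨c, hc⟩ := exists_residue hL hP (f := (l - g) / ϖ ^ n) (by
        rw [map_div₀, hϖn]
        exact div_le_one_of_le₀ hlg zero_le)
      refine ⟨g + algebraMap k L c * ϖ ^ n, ?_, ?_⟩
      · rw [map_add, map_mul, map_pow, ← IsScalarTower.algebraMap_apply,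
          IsScalarTower.algebraMap_apply k M F]
        refine hg.add (.algebraMap_mul ?_ (.pow ha hϖF hμ h n))
        rw [← IsScalarTower.algebraMap_apply]
        exact valuation_const_le_one hQ.2 c
      · have : l - (g + algebraMap k L c * ϖ ^ n) =
            ((l - g) / ϖ ^ n - algebraMap k L c) * ϖ ^ n := by
          rw [sub_mul, div_mul_cancel₀ _ (pow_ne_zero _ hϖ0), sub_add_eq_sub_sub]
        rw [this, map_mul, hϖn]
        refine (mul_le_mul_left (lt_one_iff_le_exp_neg_one.mp hc) _).trans ?_
        rw [← exp_add, exp_le_exp]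
        push_cast
        lia
  obtain ⟨g, hg, hlg⟩ := key N
  rw [← sub_add_cancel l g, map_add]
  refine .add (.of_le ?_) hg
  rw [hPQ]
  exact (pow_le_of_le_one zero_le (hlg.trans (by rw [← exp_zero, exp_le_exp]; lia)) hp.ne').trans hlg

/-- A nonzero `M`-linear combination of `1, ϖ, …, ϖ ^ (a - 1)` has order divisible by `h`, when
`Q ϖ = exp (-(b * h))` with `b` prime to `a` and `e(Q/R) = a * h`. -/
lemma valuation_sum_mem {a b h : ℕ} (hh : 0 < h) (hab : a.Coprime b)
    (hRQ : LiesOverE Q (algebraMap M F) R (a * h)) {ϖ : F} (hϖ : Q ϖ = exp (-((b * h : ℕ) : ℤ)))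
    {m : ℕ → M} (hm : ∑ i ∈ Finset.range a, algebraMap M F (m i) * ϖ ^ i ≠ 0) :
    ∃ n : ℤ, Q (∑ i ∈ Finset.range a, algebraMap M F (m i) * ϖ ^ i) = exp (h * n) := by
  have hval (i : ℕ) (hi : m i ≠ 0) : Q (algebraMap M F (m i) * ϖ ^ i) =
      exp (h * (a * log (R (m i)) - b * i)) := by
    have hR := exp_log ((R.ne_zero_iff).mpr hi)
    rw [map_mul, map_pow, hRQ.2, hϖ]
    conv_lhs => rw [← hR]
    rw [exp_pow_int, exp_pow_int, ← exp_add]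
    congr 1
    push_cast
    ring
  have hne {i : ℕ} (h : algebraMap M F (m i) * ϖ ^ i ≠ 0) : m i ≠ 0 := by
    intro h0
    simp [h0] at h
  have hdistinct : ∀ i ∈ Finset.range a, ∀ j ∈ Finset.range a, i ≠ j →
      algebraMap M F (m i) * ϖ ^ i ≠ 0 →
      Q (algebraMap M F (m i) * ϖ ^ i) ≠ Q (algebraMap M F (m j) * ϖ ^ j) := by
    intro i hi j hj hij hi0 heq
    have hj0 : algebraMap M F (m j) * ϖ ^ j ≠ 0 := by
      rw [← Q.ne_zero_iff, ← heq]
      exact Q.ne_zero_iff.mpr hi0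
    rw [hval i (hne hi0), hval j (hne hj0), exp_inj] at heq
    have heq := mul_left_cancel₀ (by exact_mod_cast hh.ne' : (h : ℤ) ≠ 0) heq
    have hdvd : (a : ℤ) ∣ b * ((i : ℤ) - j) :=
      ⟨log (R (m i)) - log (R (m j)), by linear_combination -heq⟩
    have hdvd := (Nat.isCoprime_iff_coprime.mpr hab).dvd_of_dvd_mul_left hdvd
    rw [Finset.mem_range] at hi hj
    have := Int.eq_zero_of_abs_lt_dvd hdvd (by rw [abs_lt]; lia)
    lia
  obtain ⟨i, -, hi0, hi⟩ := exists_valuation_sum_eq (w := Q) _ _ hdistinct hm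
  exact ⟨_, hi.trans (hval i (hne hi0))⟩

/-- Every element of `F = L.M` becomes approximable to any precision after scaling by an element
of `M` not depending on the precision. -/
lemma exists_mul_isApproxBy {k : Type*} [Field k] [IsAlgClosed k] [Algebra k L]
    [Algebra k M] [Algebra k F] [IsScalarTower k L F] [IsScalarTower k M F]
    (hL : IsFunctionFieldOver k L) (hP : IsPlace (k := k) P) (hQ : IsPlace (k := k) Q)
    (hPQ : LiesOverE Q (algebraMap L F) P p) (hRQ : LiesOverE Q (algebraMap M F) R r)
    {a n n' : ℕ} (ha : 0 < a) (hn : 0 < n) {tL : L} {tM : M}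
    (ht : algebraMap L F tL = algebraMap M F tM)
    (htL : P tL = exp (-(n : ℤ))) (htM : R tM = exp (-(n' : ℤ))) {x : F}
    (hx : x ∈ AddSubmonoid.closure
      {z : F | ∃ (l : L) (m : M), z = algebraMap L F l * algebraMap M F m}) :
    ∃ D : M, D ≠ 0 ∧ R D ≤ 1 ∧ ∀ (N : ℕ) (ϖ : L) (μ : M), P ϖ = exp (-1) → R μ ≤ 1 →
      Q (algebraMap L F ϖ ^ a - algebraMap M F μ) ≤ exp (-(N : ℤ)) →
      IsApproxBy M Q (algebraMap L F ϖ) a N (algebraMap M F D * x) := by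
  have hint {m : M} (hm : R m ≤ 1) : Q (algebraMap M F m) ≤ 1 := by
    rw [hRQ.2]
    exact pow_le_one' hm r
  have htM0 : tM ≠ 0 := by
    rw [← R.ne_zero_iff, htM]
    exact exp_ne_zero
  induction hx using AddSubmonoid.closure_induction with
  | zero => exact ⟨1, one_ne_zero, by simp, fun N ϖ μ _ _ _ ↦ .of_le (by simp)⟩
  | add x y _ _ hx hy =>
    obtain ⟨D, hD0, hD, hDx⟩ := hx
    obtain ⟨E, hE0, hE, hEy⟩ := hy
    refine ⟨D * E, mul_ne_zero hD0 hE0, ?_, fun N ϖ μ hϖ hμ h ↦ ?_⟩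
    · rw [map_mul]
      exact mul_le_one' hD hE
    · have : algebraMap M F (D * E) * (x + y) = algebraMap M F E * (algebraMap M F D * x) +
          algebraMap M F D * (algebraMap M F E * y) := by
        rw [map_mul]
        ring
      rw [this]
      exact ((hDx N ϖ μ hϖ hμ h).algebraMap_mul (hint hE)).add
        ((hEy N ϖ μ hϖ hμ h).algebraMap_mul (hint hD))
  | mem x hx =>
    obtain ⟨l, m, rfl⟩ := hx
    obtain ⟨E, hE0, hE, hEm⟩ : ∃ E : M, E ≠ 0 ∧ R E ≤ 1 ∧ R (E * m) ≤ 1 := by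
      rcases le_total (R m) 1 with hm | hm
      · exact ⟨1, one_ne_zero, by simp, by simpa using hm⟩
      · have hm0 : m ≠ 0 := by
          rintro rfl
          simp at hm
        refine ⟨m⁻¹, inv_ne_zero hm0, ?_, by simp [hm0]⟩
        rw [map_inv₀]
        exact inv_le_one_of_one_le₀ hm
    set q := (log (P l)).toNat with hq
    have hl : P (tL ^ q * l) ≤ 1 := by
      rw [map_mul, map_pow, htL]
      refine (mul_le_mul_right le_exp_log _).trans ?_
      rw [exp_pow_int, ← exp_add, ← exp_zero, exp_le_exp]
      have h1 : log (P l) ≤ q := Int.self_le_toNat _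
      have h2 : (q : ℤ) ≤ q * n := le_mul_of_one_le_right (by lia) (by exact_mod_cast hn)
      linarith
    refine ⟨E * tM ^ q, mul_ne_zero hE0 (pow_ne_zero _ htM0), ?_, fun N ϖ μ hϖ hμ h ↦ ?_⟩
    · rw [map_mul, map_pow, htM, exp_pow_int]
      refine mul_le_one' hE ?_
      rw [← exp_zero, exp_le_exp]
      exact mul_nonpos_of_nonneg_of_nonpos (by lia) (by lia)
    · have : algebraMap M F (E * tM ^ q) * (algebraMap L F l * algebraMap M F m) =
          algebraMap M F (E * m) * algebraMap L F (tL ^ q * l) := by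
        rw [map_mul, map_mul, map_mul, map_pow, map_pow, ht]
        ring
      rw [this]
      exact .algebraMap_mul (hint hEm) (isApproxBy_algebraMap hL hP hQ hPQ ha hϖ (hint hμ) h hl)

/-- Abhyankar's lemma for a compositum `F = L.M` whose place `Q` lies over a tame place `P`. -/
lemma eq_one_of_tame {k : Type*} [Field k] [IsAlgClosed k] [Algebra k L]
    [Algebra k M] [Algebra k F] [IsScalarTower k L F] [IsScalarTower k M F]
    (hL : IsFunctionFieldOver k L) (hM : IsFunctionFieldOver k M)
    (hP : IsPlace (k := k) P) (hR : IsPlace (k := k) R) (hQ : IsPlace (k := k) Q)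
    {a b d h : ℕ} (hab : a.Coprime b) (had : ¬ ringChar k ∣ a * d)
    (hPQ : LiesOverE Q (algebraMap L F) P (b * h)) (hRQ : LiesOverE Q (algebraMap M F) R (a * h))
    {tL : L} {tM : M} (ht : algebraMap L F tL = algebraMap M F tM)
    (htL : P tL = exp (-((a * d : ℕ) : ℤ))) (htM : R tM = exp (-((b * d : ℕ) : ℤ)))
    (hF : ∀ x : F, x ∈ AddSubmonoid.closure
      {z : F | ∃ (l : L) (m : M), z = algebraMap L F l * algebraMap M F m}) : h = 1 := by
  have had0 : 0 < a * d := Nat.pos_of_ne_zero fun h ↦ by simp [h] at had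
  have ha : 0 < a := Nat.pos_of_mul_pos_right had0
  have hh : 0 < h := Nat.pos_of_mul_pos_left hRQ.1
  obtain ⟨x, hx⟩ := hQ.1 (exp 1)
  obtain ⟨D, hD0, -, hD⟩ := exists_mul_isApproxBy hL hP hQ hPQ hRQ ha had0 ht htL htM (hF x)
  have hDx : Q (algebraMap M F D * x) = exp (((a * h : ℕ) : ℤ) * log (R D) + 1) := by
    rw [map_mul, hx, hRQ.2, exp_add, ← exp_pow_int, exp_log (R.ne_zero_iff.mpr hD0)]
  obtain ⟨N, hN⟩ := exists_exp_neg_natCast_lt (x := Q (algebraMap M F D * x))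
    (hDx ▸ exp_ne_zero)
  obtain ⟨ϖ, μ, hϖ, hμ, happ⟩ := exists_uniformizer_pow_approx hL hM hP hR hQ hPQ hRQ had
    (by ring) ht htL htM N
  obtain ⟨m, hm⟩ := hD N ϖ μ hϖ hμ happ
  have hsum := Q.map_sub_eq_of_lt_left (hm.trans_lt hN)
  rw [sub_sub_cancel, hDx] at hsum
  have hϖF : Q (algebraMap L F ϖ) = exp (-((b * h : ℕ) : ℤ)) := by
    rw [hPQ.2, hϖ, exp_pow_int, mul_neg_one]
  obtain ⟨n, hn⟩ := valuation_sum_mem hh hab hRQ hϖF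
    (Q.ne_zero_iff.mp (hsum ▸ exp_ne_zero))
  rw [hsum, exp_inj] at hn
  have : (h : ℤ) ∣ 1 := ⟨n - a * log (R D), by push_cast at hn; linear_combination hn⟩
  exact Nat.dvd_one.mp (by exact_mod_cast this)

/-- The compositum formula `e(Q/S) = lcm(e(P/S), e(R/S))` when `P` is the tame place. -/
lemma ramification_eq_lcm_of_tame {k K : Type*} [Field k] [IsAlgClosed k] [Field K] [Algebra k L]
    [Algebra k M] [Algebra k F] [IsScalarTower k L F] [IsScalarTower k M F]
    [Algebra K L] [Algebra K M] [Algebra K F] [IsScalarTower K L F] [IsScalarTower K M F]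
    (hL : IsFunctionFieldOver k L) (hM : IsFunctionFieldOver k M) {S : Valuation K ℤᵐ⁰}
    (hS : Function.Surjective S)
    (hP : IsPlace (k := k) P) (hR : IsPlace (k := k) R) (hQ : IsPlace (k := k) Q)
    {eP eR eQ : ℕ} (htame : ¬ ringChar k ∣ eP)
    (hSP : LiesOverE P (algebraMap K L) S eP) (hSR : LiesOverE R (algebraMap K M) S eR)
    (hSQ : LiesOverE Q (algebraMap K F) S eQ)
    (hPQ : LiesOver Q (algebraMap L F) P) (hRQ : LiesOver Q (algebraMap M F) R)
    (hF : ∀ x : F, x ∈ AddSubmonoid.closure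
      {z : F | ∃ (l : L) (m : M), z = algebraMap L F l * algebraMap M F m}) :
    eQ = Nat.lcm eP eR := by
  obtain ⟨p, hPQ⟩ := hPQ
  obtain ⟨r, hRQ⟩ := hRQ
  obtain ⟨t, ht⟩ := hS (exp (-1))
  have hPt : P (algebraMap K L t) = exp (-(eP : ℤ)) := by
    rw [hSP.2, ht, exp_pow_int, mul_neg_one]
  have hRt : R (algebraMap K M t) = exp (-(eR : ℤ)) := by
    rw [hSR.2, ht, exp_pow_int, mul_neg_one]
  have hQt : Q (algebraMap K F t) = exp (-(eQ : ℤ)) := by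
    rw [hSQ.2, ht, exp_pow_int, mul_neg_one]
  have hp : eQ = p * eP := by
    rw [IsScalarTower.algebraMap_apply K L F, hPQ.2, hPt, exp_pow_int, exp_inj] at hQt
    exact_mod_cast (by linear_combination hQt : (eQ : ℤ) = p * eP)
  have hr : eQ = r * eR := by
    rw [IsScalarTower.algebraMap_apply K M F, hRQ.2, hRt, exp_pow_int, exp_inj] at hQt
    exact_mod_cast (by linear_combination hQt : (eQ : ℤ) = r * eR)
  obtain ⟨h, hh⟩ := Nat.lcm_dvd (Dvd.intro_left p hp.symm) (Dvd.intro_left r hr.symm)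
  obtain ⟨d, a, b, hd, hab, rfl, rfl⟩ := Nat.exists_coprime' (Nat.gcd_pos_of_pos_left eR hSP.1)
  have hlcm : (a * d).lcm (b * d) = a * b * d := by
    rw [Nat.lcm_mul_right, hab.lcm_eq_mul]
  have ha : 0 < a := Nat.pos_of_mul_pos_right hSP.1
  have hb : 0 < b := Nat.pos_of_mul_pos_right hSR.1
  rw [hlcm] at hh
  have hp' : p = b * h :=
    Nat.eq_of_mul_eq_mul_right hSP.1 (by rw [← hp, hh]; ring)
  have hr' : r = a * h :=
    Nat.eq_of_mul_eq_mul_right hSR.1 (by rw [← hr, hh]; ring)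
  subst hp' hr'
  have h1 := eq_one_of_tame hL hM hP hR hQ hab htame hPQ hRQ
    (by rw [← IsScalarTower.algebraMap_apply, ← IsScalarTower.algebraMap_apply]) hPt hRt hF
  rw [hh, h1, mul_one, hlcm]

end Compositum

/-- **Corollary (ramification over two given places is the lcm).**
Let `L/K` and `M/K` be finite separable extensions of function fields of curves over an
algebraically closed field `k`, and let `L ⊗[K] M ≃ F₁ × ⋯ × Fₙ` be the decomposition into
fields.  Let `S`, `P`, `R` be places of `K`, `L`, `M` with `P`, `R` lying over `S` and at
least one of `P`, `R` tamely ramified over `S`.  Then every place `Q` of any `Fᵢ` lying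
over both `P` and `R` satisfies `e(Q/S) = lcm(e(P/S), e(R/S))`. -/
theorem ramification_lcm
    {k K L M : Type*} [Field k] [IsAlgClosed k] [Field K] [Field L] [Field M]
    [Algebra k K] [Algebra k L] [Algebra k M]
    [Algebra K L] [Algebra K M] [IsScalarTower k K L] [IsScalarTower k K M]
    (hK : IsFunctionFieldOver k K) (hL : IsFunctionFieldOver k L)
    (hM : IsFunctionFieldOver k M)
    [FiniteDimensional K L] [FiniteDimensional K M]
    -- the decomposition of `L ⊗[K] M` as a finite product of fields `Fᵢ`
    {n : ℕ} (F : Fin n → Type*) [∀ i, Field (F i)]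
    [∀ i, Algebra k (F i)] [∀ i, Algebra K (F i)] [∀ i, Algebra L (F i)]
    [∀ i, Algebra M (F i)] [∀ i, IsScalarTower k K (F i)]
    [∀ i, IsScalarTower K L (F i)] [∀ i, IsScalarTower K M (F i)]
    (e : (L ⊗[K] M) ≃ₐ[K] ((i : Fin n) → F i))
    (he : ∀ (i : Fin n) (l : L) (m : M),
      e (l ⊗ₜ[K] m) i = algebraMap L (F i) l * algebraMap M (F i) m)
    -- the places `S`, `P`, `R`, with `P` and `R` lying over `S`
    (S : Valuation K (WithZero (Multiplicative ℤ)))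
    (P : Valuation L (WithZero (Multiplicative ℤ)))
    (R : Valuation M (WithZero (Multiplicative ℤ)))
    (hS : IsPlace (k := k) S) (hP : IsPlace (k := k) P) (hR : IsPlace (k := k) R)
    (hPS : LiesOver P (algebraMap K L) S) (hRS : LiesOver R (algebraMap K M) S)
    [Algebra.IsSeparable K L] [Algebra.IsSeparable K M] :
    ∀ eP eR : ℕ, LiesOverE P (algebraMap K L) S eP → LiesOverE R (algebraMap K M) S eR →
      -- at least one of `P`, `R` is tamely ramified over `S`
      (¬ (ringChar k ∣ eP) ∨ ¬ (ringChar k ∣ eR)) →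
      ∀ (i : Fin n) (Q : Valuation (F i) (WithZero (Multiplicative ℤ))) (eQ : ℕ),
        IsPlace (k := k) Q →
        LiesOver Q (algebraMap L (F i)) P → LiesOver Q (algebraMap M (F i)) R →
        LiesOverE Q (algebraMap K (F i)) S eQ →
        eQ = Nat.lcm eP eR := by
  intro eP eR heP heR htame i Q eQ hQ hQP hQR hQS
  have (i : Fin n) : IsScalarTower k L (F i) := .of_algebraMap_eq fun c ↦ by
    rw [IsScalarTower.algebraMap_apply k K L, ← IsScalarTower.algebraMap_apply K L,
      ← IsScalarTower.algebraMap_apply k K (F i)]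
  have (i : Fin n) : IsScalarTower k M (F i) := .of_algebraMap_eq fun c ↦ by
    rw [IsScalarTower.algebraMap_apply k K M, ← IsScalarTower.algebraMap_apply K M,
      ← IsScalarTower.algebraMap_apply k K (F i)]
  have hspan (x : F i) : x ∈ AddSubmonoid.closure
      {z : F i | ∃ (l : L) (m : M), z = algebraMap L (F i) l * algebraMap M (F i) m} := by
    have hT (T : L ⊗[K] M) : e T i ∈ AddSubmonoid.closure
        {z : F i | ∃ (l : L) (m : M), z = algebraMap L (F i) l * algebraMap M (F i) m} := by
      induction T with
      | zero => simp
      | add T U hT hU =>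
        rw [map_add]
        exact add_mem hT hU
      | tmul l m => exact AddSubmonoid.subset_closure ⟨l, m, he i l m⟩
    simpa using hT (e.symm (Pi.single i x))
  rcases htame with htame | htame
  · exact ramification_eq_lcm_of_tame hL hM hS.1 hP hR hQ htame heP heR hQS hQP hQR hspan
  · rw [Nat.lcm_comm]
    refine ramification_eq_lcm_of_tame hM hL hS.1 hR hP hQ htame heR heP hQS hQR hQP fun x ↦ ?_
    refine AddSubmonoid.closure_mono ?_ (hspan x)
    rintro _ ⟨l, m, rfl⟩
    exact ⟨m, l, mul_comm _ _⟩
end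
end
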